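/- arXiv:1811.08518 — 2 statements merged into one kernel-verified Lean document; each statement's English description precedes it below -/
import Mathlib

section
/- Let Γ and Δ be the explicit simplicial complexes on vertex set {A,…,L} described as follows: Γ is generated by ABCE, BCEF, BCDF, ABCG, BCGH, BCDH, ABEG, BEFG, BFGH, and Δ is generated by these together with ABCJ, ABIJ, BCIJ, BCDI, CDIJ, ABEK, ABIK, BEIK, BEFI, EFIK, ABGL, ABIL, BGIL, BGHI, GHIL, CDFK, CDJK, CFJK, CEFJ, EFJK, CDHL, CDJL, CHJL, CGHJ, GHJL, EFGL, EFKL, FGKL, FGHK, GHKL. For N ≥ 1 let Ω_N be the simplicial complex on vertex set {A,…,H} ∪ {I_m, J_m, K_m, L_m : 1 ≤ m ≤ N} whose faces are the faces of Γ together with, for each m ∈ {1,…,N}, the images of the faces of Δ ∖ Γ under the injection fixing A,…,H and sending I,J,K,L to I_m,J_m,K_m,L_m (i.e., Ω_N is obtained by gluing N copies of Δ along Γ). Then for every N ≥ 17, the face poset of Ω_N cannot be written as a union of pairwise disjoint rank 2 boolean intervals. -/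
open Finset

/-- `pairs` is a family of pairwise disjoint rank `k` boolean intervals whose union is `P`. -/
def IsBooleanDecomposition {V : Type*} [DecidableEq V] (k : ℕ)
    (pairs : Set (Finset V × Finset V)) (P : Set (Finset V)) : Prop :=
  (∀ p ∈ pairs, p.1 ⊆ p.2 ∧ (p.2 \ p.1).card = k) ∧
  (P = ⋃ p ∈ pairs, ↑(Finset.Icc p.1 p.2)) ∧
  pairs.PairwiseDisjoint (fun p => (↑(Finset.Icc p.1 p.2) : Set (Finset V)))

/-- `P` can be written as a union of pairwise disjoint rank `k` boolean intervals. -/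
def BooleanDecomposable {V : Type*} [DecidableEq V] (k : ℕ) (P : Set (Finset V)) : Prop :=
  ∃ pairs, IsBooleanDecomposition k pairs P

/-- The complex generated by a list of faces: all subsets of the members of `L`. -/
def genL {V : Type*} [DecidableEq V] (L : List (Finset V)) : Finset (Finset V) :=
  L.toFinset.biUnion Finset.powerset

/-- The facets of Γ, with vertices A,…,L encoded as 0,…,11:
ABCE, BCEF, BCDF, ABCG, BCGH, BCDH, ABEG, BEFG, BFGH. -/
def GammaFacets : List (Finset ℕ) :=
  [{0,1,2,4}, {1,2,4,5}, {1,2,3,5}, {0,1,2,6}, {1,2,6,7}, {1,2,3,7},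
   {0,1,4,6}, {1,4,5,6}, {1,5,6,7}]

/-- The thirty additional facets of Δ. -/
def DeltaExtraFacets : List (Finset ℕ) :=
  [{0,1,2,9}, {0,1,8,9}, {1,2,8,9}, {1,2,3,8}, {2,3,8,9},
   {0,1,4,10}, {0,1,8,10}, {1,4,8,10}, {1,4,5,8}, {4,5,8,10},
   {0,1,6,11}, {0,1,8,11}, {1,6,8,11}, {1,6,7,8}, {6,7,8,11},
   {2,3,5,10}, {2,3,9,10}, {2,5,9,10}, {2,4,5,9}, {4,5,9,10},
   {2,3,7,11}, {2,3,9,11}, {2,7,9,11}, {2,6,7,9}, {6,7,9,11},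
   {4,5,6,11}, {4,5,10,11}, {5,6,10,11}, {5,6,7,10}, {6,7,10,11}]

/-- The simplicial complex Γ (its vertices are A,…,H, i.e. 0,…,7). -/
def GammaC : Finset (Finset ℕ) := genL GammaFacets

/-- The simplicial complex Δ. -/
def DeltaC : Finset (Finset ℕ) := genL (GammaFacets ++ DeltaExtraFacets)

/-- The injection used to produce the `m`-th copy of Δ: it fixes the vertices
A,…,H (encoded 0,…,7) and sends each of I,J,K,L (encoded 8,…,11) to its `m`-th copy. -/
def iotaC (m : ℕ) (v : ℕ) : ℕ ⊕ (ℕ × ℕ) :=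
  if v < 8 then Sum.inl v else Sum.inr (v, m)

/-- Ω_N : the complex obtained by gluing `N` copies of Δ together along Γ. Its faces are
the faces of Γ together with, for each `m ∈ {1,…,N}`, the images of the faces of Δ ∖ Γ
under `iotaC m`. -/
def OmegaC (N : ℕ) : Finset (Finset (ℕ ⊕ (ℕ × ℕ))) :=
  GammaC.image (Finset.image (iotaC 1)) ∪
    (Finset.Icc 1 N).biUnion (fun m => (DeltaC \ GammaC).image (Finset.image (iotaC m)))

theorem mem_genL {V : Type*} [DecidableEq V] {L : List (Finset V)} {s : Finset V} :
    s ∈ genL L ↔ ∃ F ∈ L, s ⊆ F := by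
  simp [genL]

/-- The faces of `Δ ∖ Γ` are the faces of the additional facets that have a vertex among
`I, J, K, L`. -/
theorem mem_deltaC_sdiff_gammaC {s : Finset ℕ} :
    s ∈ DeltaC \ GammaC ↔ (∃ F ∈ DeltaExtraFacets, s ⊆ F) ∧ ∃ v ∈ s, 8 ≤ v := by
  have hlow : ∀ F ∈ DeltaExtraFacets, ∃ G ∈ GammaFacets, F.filter (· < 8) ⊆ G := by decide
  have hΓ : ∀ G ∈ GammaFacets, ∀ v ∈ G, v < 8 := by decide
  rw [mem_sdiff, DeltaC, GammaC, mem_genL, mem_genL]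
  constructor
  · rintro ⟨⟨F, hF, hsF⟩, hs⟩
    rcases List.mem_append.1 hF with hF | hF
    · exact absurd ⟨F, hF, hsF⟩ hs
    · refine ⟨⟨F, hF, hsF⟩, ?_⟩
      by_contra! h
      obtain ⟨G, hG, hFG⟩ := hlow F hF
      exact hs ⟨G, hG, fun v hv => hFG (mem_filter.2 ⟨hsF hv, h v hv⟩)⟩
  · rintro ⟨⟨F, hF, hsF⟩, v, hv, hv8⟩
    refine ⟨⟨F, List.mem_append_right _ hF, hsF⟩, ?_⟩
    rintro ⟨G, hG, hsG⟩
    exact absurd (hΓ G hG v (hsG hv)) (by lia)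

theorem card_gammaC : GammaC.card = 64 := by
  decide +kernel

/-- The cardinality is computed after encoding faces as binary numbers. -/
theorem card_deltaC_sdiff_gammaC : (DeltaC \ GammaC).card = 136 := by
  have h : DeltaC \ GammaC = DeltaExtraFacets.toFinset.biUnion
      fun F => F.powerset.filter fun s => ∃ v ∈ s, 8 ≤ v := by
    ext s
    simp only [mem_deltaC_sdiff_gammaC, mem_biUnion, List.mem_toFinset, mem_filter, mem_powerset]
    grind
  rw [← card_image_of_injective _ (geomSum_injective (n := 2) le_rfl), h, biUnion_image]
  decide +kernel

namespace IsBooleanDecomposition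

variable {V : Type*} [DecidableEq V] {k : ℕ} {pairs : Set (Finset V × Finset V)}
  {P : Set (Finset V)}

theorem mem_iff (h : IsBooleanDecomposition k pairs P) {s : Finset V} :
    s ∈ P ↔ ∃ p ∈ pairs, p.1 ⊆ s ∧ s ⊆ p.2 := by
  rw [h.2.1]
  simp only [Set.mem_iUnion, coe_Icc, Set.mem_Icc, exists_prop]

theorem fst_mem (h : IsBooleanDecomposition k pairs P) {p : Finset V × Finset V}
    (hp : p ∈ pairs) : p.1 ∈ P :=
  h.mem_iff.2 ⟨p, hp, subset_rfl, (h.1 p hp).1⟩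

theorem snd_mem (h : IsBooleanDecomposition k pairs P) {p : Finset V × Finset V}
    (hp : p ∈ pairs) : p.2 ∈ P :=
  h.mem_iff.2 ⟨p, hp, (h.1 p hp).1, subset_rfl⟩

theorem eq_of_mem (h : IsBooleanDecomposition k pairs P) {p q : Finset V × Finset V}
    (hp : p ∈ pairs) (hq : q ∈ pairs) {s : Finset V} (hsp : s ∈ Icc p.1 p.2)
    (hsq : s ∈ Icc q.1 q.2) : p = q :=
  h.2.2.elim_set hp hq s hsp hsq

theorem eq_or_not_subset (h : IsBooleanDecomposition k pairs P) {p q : Finset V × Finset V}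
    (hp : p ∈ pairs) (hq : q ∈ pairs) : p = q ∨ ¬ p.1 ∪ q.1 ⊆ p.2 ∩ q.2 := by
  refine or_iff_not_imp_right.2 fun hs => ?_
  rw [not_not, subset_inter_iff] at hs
  exact h.eq_of_mem hp hq (mem_Icc.2 ⟨subset_union_left, hs.1⟩)
    (mem_Icc.2 ⟨subset_union_right, hs.2⟩)

theorem card_biUnion_Icc {pairs : Finset (Finset V × Finset V)}
    (h : IsBooleanDecomposition k (pairs : Set (Finset V × Finset V)) P)
    {S : Finset (Finset V × Finset V)} (hS : S ⊆ pairs) :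
    (S.biUnion fun p => Icc p.1 p.2).card = 2 ^ k * S.card := by
  rw [card_biUnion, sum_const_nat (m := 2 ^ k), mul_comm]
  · intro p hp
    obtain ⟨hsub, hcard⟩ := h.1 p (hS hp)
    rw [card_Icc_finset hsub, ← card_sdiff_of_subset hsub, hcard]
  · intro p hp q hq hpq
    exact disjoint_left.2 fun s hsp hsq => hpq (h.eq_of_mem (hS hp) (hS hq) hsp hsq)

end IsBooleanDecomposition

/-- The faces of `Δ ∖ Γ` that contain `x`, provided that `x` is such a face. -/
def cofaces (x : Finset ℕ) : Finset (Finset ℕ) :=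
  (DeltaExtraFacets.filter (x ⊆ ·)).toFinset.biUnion (Icc x)

/-- One cannot choose, for each face in a list, a rank 2 boolean interval of `Δ ∖ Γ` containing it
in such a way that any two of these intervals and those in `chosen` are equal or disjoint. -/
def NoConsistentCover : List (Finset ℕ) → List (Finset ℕ × Finset ℕ) → Prop
  | [], _ => False
  | x :: xs, chosen =>
    ∀ b ∈ cofaces x, ∀ a ∈ x.powerset, (b \ a).card = 2 → (∃ v ∈ a, 8 ≤ v) →
      (∀ p ∈ chosen, p = (a, b) ∨ ¬ p.1 ∪ a ⊆ p.2 ∩ b) → NoConsistentCover xs ((a, b) :: chosen)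

instance NoConsistentCover.decidable : ∀ xs chosen, Decidable (NoConsistentCover xs chosen)
  | [], _ => inferInstanceAs (Decidable False)
  | x :: xs, chosen =>
    have := NoConsistentCover.decidable xs
    inferInstanceAs (Decidable (∀ b ∈ cofaces x, ∀ a ∈ x.powerset, (b \ a).card = 2 →
      (∃ v ∈ a, 8 ≤ v) → (∀ p ∈ chosen, p = (a, b) ∨ ¬ p.1 ∪ a ⊆ p.2 ∩ b) →
        NoConsistentCover xs ((a, b) :: chosen)))

section

variable {pairs : Set (Finset ℕ × Finset ℕ)}

theorem IsBooleanDecomposition.exists_mem_cofaces {k : ℕ}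
    (h : IsBooleanDecomposition k pairs ↑(DeltaC \ GammaC)) {x : Finset ℕ}
    (hx : x ∈ DeltaC \ GammaC) :
    ∃ p ∈ pairs, p.2 ∈ cofaces x ∧ p.1 ∈ x.powerset ∧ (p.2 \ p.1).card = k ∧
      ∃ v ∈ p.1, 8 ≤ v := by
  obtain ⟨p, hp, hpx, hxp⟩ := h.mem_iff.1 (mem_coe.2 hx)
  obtain ⟨F, hF, hpF⟩ := (mem_deltaC_sdiff_gammaC.1 (mem_coe.1 (h.snd_mem hp))).1
  refine ⟨p, hp, ?_, mem_powerset.2 hpx, (h.1 p hp).2,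
    (mem_deltaC_sdiff_gammaC.1 (mem_coe.1 (h.fst_mem hp))).2⟩
  simp only [cofaces, mem_biUnion, List.mem_toFinset, List.mem_filter, decide_eq_true_eq]
  exact ⟨F, ⟨hF, hxp.trans hpF⟩, mem_Icc.2 ⟨hxp, hpF⟩⟩

theorem IsBooleanDecomposition.not_noConsistentCover
    (h : IsBooleanDecomposition 2 pairs ↑(DeltaC \ GammaC)) {xs : List (Finset ℕ)}
    (hxs : ∀ x ∈ xs, x ∈ DeltaC \ GammaC) {chosen : List (Finset ℕ × Finset ℕ)}
    (hchosen : ∀ p ∈ chosen, p ∈ pairs) : ¬ NoConsistentCover xs chosen := by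
  induction xs generalizing chosen with
  | nil => exact id
  | cons x xs ih =>
    intro hno
    obtain ⟨p, hp, hb, ha, hcard, hv⟩ := h.exists_mem_cofaces (hxs x List.mem_cons_self)
    exact ih (fun y hy => hxs y (List.mem_cons_of_mem _ hy)) (List.forall_mem_cons.2 ⟨hp, hchosen⟩)
      (hno p.2 hb p.1 ha hcard hv fun q hq => h.eq_or_not_subset (hchosen q hq) hp)

end

/-- The faces that lead to a contradiction once `BEI` is covered by the interval from `a` to `b`:
the interval `[EI, BEIK]` needs a list of its own. -/
def contradictoryFaces (a b : Finset ℕ) : List (Finset ℕ) :=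
  if a = {4, 8} ∧ b = {1, 4, 8, 10} then
    [{1, 4, 5, 8}, {4, 5, 8, 10}, {3, 5, 10}, {2, 5, 10}, {5, 7, 10}, {5, 6, 10}, {2, 3, 9, 10},
      {6, 7, 10, 11}, {3, 7, 11}, {2, 7, 11}, {3, 9, 11}]
  else
    [{1, 5, 8}, {1, 3, 8}, {1, 2, 8}, {2, 8}, {1, 7, 8}, {1, 6, 8}, {6, 8}, {2, 3, 8, 9},
      {6, 7, 8, 11}, {3, 7, 11}, {2, 7, 11}, {3, 9, 11}]

theorem mem_of_mem_contradictoryFaces {a b x : Finset ℕ} (hx : x ∈ contradictoryFaces a b) :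
    x ∈ DeltaC \ GammaC := by
  have h : ∀ y ∈ contradictoryFaces a b, (∃ F ∈ DeltaExtraFacets, y ⊆ F) ∧ ∃ v ∈ y, 8 ≤ v := by
    unfold contradictoryFaces
    split_ifs <;> decide +kernel
  exact mem_deltaC_sdiff_gammaC.2 (h x hx)

theorem noConsistentCover_contradictoryFaces :
    ∀ b ∈ cofaces {1, 4, 8}, ∀ a ∈ ({1, 4, 8} : Finset ℕ).powerset, (b \ a).card = 2 →
      (∃ v ∈ a, 8 ≤ v) → NoConsistentCover (contradictoryFaces a b) [(a, b)] := by
  unfold contradictoryFaces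
  decide +kernel

theorem not_booleanDecomposable_deltaC_sdiff_gammaC :
    ¬ BooleanDecomposable 2 (↑(DeltaC \ GammaC) : Set (Finset ℕ)) := by
  rintro ⟨pairs, h⟩
  have hx : ({1, 4, 8} : Finset ℕ) ∈ DeltaC \ GammaC :=
    mem_deltaC_sdiff_gammaC.2 (by decide +kernel)
  obtain ⟨p, hp, hb, ha, hcard, hv⟩ := h.exists_mem_cofaces hx
  exact h.not_noConsistentCover (fun _ => mem_of_mem_contradictoryFaces) (by simpa using hp)
    (noConsistentCover_contradictoryFaces p.2 hb p.1 ha hcard hv)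

theorem iotaC_injective (m : ℕ) : Function.Injective (iotaC m) := by
  intro v w h
  unfold iotaC at h
  split_ifs at h <;> simp_all

theorem inr_eq_iotaC_iff {m v w k : ℕ} : Sum.inr (w, k) = iotaC m v ↔ 8 ≤ v ∧ w = v ∧ k = m := by
  unfold iotaC
  split_ifs <;> simp_all

/-- The copy of `Γ` in `Ω_N`. -/
def omegaCore : Finset (Finset (ℕ ⊕ (ℕ × ℕ))) :=
  GammaC.image (Finset.image (iotaC 1))

/-- The `m`-th copy of `Δ ∖ Γ` in `Ω_N`. -/
def omegaCopy (m : ℕ) : Finset (Finset (ℕ ⊕ (ℕ × ℕ))) :=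
  (DeltaC \ GammaC).image (Finset.image (iotaC m))

theorem mem_omegaC {N : ℕ} {t : Finset (ℕ ⊕ (ℕ × ℕ))} :
    t ∈ OmegaC N ↔ t ∈ omegaCore ∨ ∃ m ∈ Icc 1 N, t ∈ omegaCopy m := by
  simp only [OmegaC, mem_union, mem_biUnion, omegaCore, omegaCopy]

theorem image_mem_omegaCopy {m : ℕ} {s : Finset ℕ} :
    s.image (iotaC m) ∈ omegaCopy m ↔ s ∈ DeltaC \ GammaC :=
  (image_injective (iotaC_injective m)).mem_finset_image

theorem card_omegaCopy (m : ℕ) : (omegaCopy m).card = 136 := by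
  rw [omegaCopy, card_image_of_injective _ (image_injective (iotaC_injective m)),
    card_deltaC_sdiff_gammaC]

theorem card_omegaCore_le : omegaCore.card ≤ 64 :=
  card_image_le.trans card_gammaC.le

theorem inr_notMem_of_mem_omegaCore {t : Finset (ℕ ⊕ (ℕ × ℕ))} (ht : t ∈ omegaCore)
    (p : ℕ × ℕ) : Sum.inr p ∉ t := by
  have hΓ : ∀ G ∈ GammaFacets, ∀ v ∈ G, v < 8 := by decide
  obtain ⟨s, hs, rfl⟩ := mem_image.1 ht
  obtain ⟨G, hG, hsG⟩ := mem_genL.1 hs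
  intro hp
  obtain ⟨v, hv, hvp⟩ := mem_image.1 hp
  exact absurd (inr_eq_iotaC_iff.1 hvp.symm).1 (hΓ G hG v (hsG hv)).not_ge

theorem exists_inr_mem_of_mem_omegaCopy {m : ℕ} {t : Finset (ℕ ⊕ (ℕ × ℕ))}
    (ht : t ∈ omegaCopy m) : ∃ v, Sum.inr (v, m) ∈ t := by
  obtain ⟨s, hs, rfl⟩ := mem_image.1 ht
  obtain ⟨v, hv, hv8⟩ := (mem_deltaC_sdiff_gammaC.1 hs).2
  exact ⟨v, mem_image.2 ⟨v, hv, (inr_eq_iotaC_iff.2 ⟨hv8, rfl, rfl⟩).symm⟩⟩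

theorem eq_of_inr_mem_of_mem_omegaCopy {m k v : ℕ} {t : Finset (ℕ ⊕ (ℕ × ℕ))}
    (ht : t ∈ omegaCopy m) (hv : Sum.inr (v, k) ∈ t) : k = m := by
  obtain ⟨s, -, rfl⟩ := mem_image.1 ht
  obtain ⟨w, -, hw⟩ := mem_image.1 hv
  exact (inr_eq_iotaC_iff.1 hw.symm).2.2

theorem eq_of_subset_of_mem_omegaCopy {m k : ℕ} {s t : Finset (ℕ ⊕ (ℕ × ℕ))} (hst : s ⊆ t)
    (hs : s ∈ omegaCopy k) (ht : t ∈ omegaCopy m) : k = m := by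
  obtain ⟨v, hv⟩ := exists_inr_mem_of_mem_omegaCopy hs
  exact eq_of_inr_mem_of_mem_omegaCopy ht (hst hv)

theorem mem_omegaCopy_of_subset {N m : ℕ} {s t : Finset (ℕ ⊕ (ℕ × ℕ))} (hst : s ⊆ t)
    (hs : s ∈ omegaCopy m) (ht : t ∈ OmegaC N) : t ∈ omegaCopy m := by
  rcases mem_omegaC.1 ht with ht | ⟨k, -, ht⟩
  · obtain ⟨v, hv⟩ := exists_inr_mem_of_mem_omegaCopy hs
    exact absurd (hst hv) (inr_notMem_of_mem_omegaCore ht _)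
  · rwa [eq_of_subset_of_mem_omegaCopy hst hs ht]

theorem mem_omegaCopy_or_mem_omegaCore {N m : ℕ} {s t : Finset (ℕ ⊕ (ℕ × ℕ))} (hst : s ⊆ t)
    (hs : s ∈ OmegaC N) (ht : t ∈ omegaCopy m) : s ∈ omegaCopy m ∨ s ∈ omegaCore := by
  rcases mem_omegaC.1 hs with hs | ⟨k, -, hs⟩
  · exact Or.inr hs
  · rw [← eq_of_subset_of_mem_omegaCopy hst hs ht]
    exact Or.inl hs

/-- The `m`-th copy of `Δ ∖ Γ` is not a disjoint union of boolean intervals of rank 2. -/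
theorem not_booleanDecomposable_omegaCopy (m : ℕ) :
    ¬ BooleanDecomposable 2 (↑(omegaCopy m) : Set (Finset (ℕ ⊕ (ℕ × ℕ)))) := by
  rintro ⟨pairs, h⟩
  have hinj := iotaC_injective m
  refine not_booleanDecomposable_deltaC_sdiff_gammaC
    ⟨{q | (q.1.image (iotaC m), q.2.image (iotaC m)) ∈ pairs}, ?_, ?_, ?_⟩
  · intro q hq
    obtain ⟨hsub, hcard⟩ := h.1 _ hq
    rw [← image_sdiff _ _ hinj, card_image_of_injective _ hinj] at hcard
    exact ⟨(image_subset_image_iff hinj).1 hsub, hcard⟩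
  · ext s
    rw [mem_coe, ← image_mem_omegaCopy (m := m), ← mem_coe, h.mem_iff]
    simp only [Set.mem_ofPred_eq, Set.mem_iUnion, coe_Icc, Set.mem_Icc, exists_prop]
    constructor
    · rintro ⟨p, hp, hps, hsp⟩
      obtain ⟨a, -, ha⟩ := mem_image.1 (mem_coe.1 (h.fst_mem hp))
      obtain ⟨b, -, hb⟩ := mem_image.1 (mem_coe.1 (h.snd_mem hp))
      rw [← ha, image_subset_image_iff hinj] at hps
      rw [← hb, image_subset_image_iff hinj] at hsp
      exact ⟨(a, b), by simpa only [ha, hb] using hp, hps, hsp⟩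
    · rintro ⟨q, hq, hqs, hsq⟩
      exact ⟨_, hq, image_subset_image hqs, image_subset_image hsq⟩
  · intro q hq r hr hqr
    refine Set.disjoint_left.2 fun s hsq hsr => hqr ?_
    simp only [coe_Icc, Set.mem_Icc] at hsq hsr
    have := h.eq_of_mem hq hr (s := s.image (iotaC m))
      (mem_Icc.2 ⟨image_subset_image hsq.1, image_subset_image hsq.2⟩)
      (mem_Icc.2 ⟨image_subset_image hsr.1, image_subset_image hsr.2⟩)
    exact Prod.ext (image_injective hinj (Prod.ext_iff.1 this).1)
      (image_injective hinj (Prod.ext_iff.1 this).2)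

/-- For every N ≥ 17, the face poset of Ω_N cannot be written as a union of
pairwise disjoint rank 2 boolean intervals. -/
theorem omega_not_rank_two_boolean_decomposable :
    ∀ N : ℕ, 17 ≤ N → ¬ BooleanDecomposable 2 (↑(OmegaC N) : Set (Finset (ℕ ⊕ (ℕ × ℕ)))) := by
  rintro N hN ⟨pairs, h⟩
  have hfin : pairs.Finite := (OmegaC N ×ˢ OmegaC N).finite_toSet.subset fun p hp =>
    mem_coe.2 (mem_product.2 ⟨mem_coe.1 (h.fst_mem hp), mem_coe.1 (h.snd_mem hp)⟩)
  lift pairs to Finset (Finset (ℕ ⊕ (ℕ × ℕ)) × Finset (ℕ ⊕ (ℕ × ℕ))) using hfin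
  let S (m : ℕ) := pairs.filter fun p => p.2 ∈ omegaCopy m
  let U (m : ℕ) := (S m).biUnion fun p => Icc p.1 p.2
  have hS (m : ℕ) : S m ⊆ pairs := filter_subset _ _
  have hcopyU (m : ℕ) (hm : m ∈ Icc 1 N) : omegaCopy m ⊆ U m := by
    intro s hs
    obtain ⟨p, hp, hps, hsp⟩ := h.mem_iff.1 (mem_coe.2 (mem_omegaC.2 (Or.inr ⟨m, hm, hs⟩)))
    exact mem_biUnion.2 ⟨p, mem_filter.2 ⟨hp, mem_omegaCopy_of_subset hsp hs (h.snd_mem hp)⟩,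
      mem_Icc.2 ⟨hps, hsp⟩⟩
  have hUcore (m : ℕ) : U m \ omegaCopy m ⊆ omegaCore := by
    intro s hs
    obtain ⟨hsU, hsm⟩ := mem_sdiff.1 hs
    obtain ⟨p, hp, hsp⟩ := mem_biUnion.1 hsU
    rw [mem_Icc] at hsp
    exact (mem_omegaCopy_or_mem_omegaCore hsp.2 (h.mem_iff.2 ⟨p, hS m hp, hsp⟩)
      (mem_filter.1 hp).2).resolve_left hsm
  have hdisj : (Icc 1 N : Set ℕ).PairwiseDisjoint fun m => U m \ omegaCopy m := by
    intro m _ k _ hmk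
    refine disjoint_left.2 fun s hsm hsk => hmk ?_
    obtain ⟨p, hp, hsp⟩ := mem_biUnion.1 (mem_sdiff.1 hsm).1
    obtain ⟨q, hq, hsq⟩ := mem_biUnion.1 (mem_sdiff.1 hsk).1
    obtain rfl := h.eq_of_mem (hS m hp) (hS k hq) hsp hsq
    exact eq_of_subset_of_mem_omegaCopy subset_rfl (mem_filter.1 hp).2 (mem_filter.1 hq).2
  obtain ⟨m, hm, hlt⟩ : ∃ m ∈ Icc 1 N, (U m \ omegaCopy m).card < 4 := by
    by_contra! hge
    have hle := card_nsmul_le_sum _ _ _ hge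
    rw [← card_biUnion hdisj, Nat.card_Icc, smul_eq_mul] at hle
    have hcore : (Icc 1 N).biUnion (fun m => U m \ omegaCopy m) ⊆ omegaCore :=
      biUnion_subset.2 fun m _ => hUcore m
    have := (card_le_card hcore).trans card_omegaCore_le
    lia
  have hcard : (U m).card = 2 ^ 2 * (S m).card := h.card_biUnion_Icc (hS m)
  have hsdiff := card_sdiff_add_card_eq_card (hcopyU m hm)
  rw [card_omegaCopy] at hsdiff
  have hempty : (U m \ omegaCopy m).card = 0 := by lia
  have hU : U m = omegaCopy m :=
    (sdiff_eq_empty_iff_subset.1 (card_eq_zero.1 hempty)).antisymm (hcopyU m hm)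
  refine not_booleanDecomposable_omegaCopy m
    ⟨↑(S m), fun p hp => h.1 p (hS m hp), ?_, h.2.2.subset (hS m)⟩
  rw [← hU]
  exact coe_biUnion
end

section
/- Let Δ be a d-dimensional stacked simplicial complex with j facets. Then the f-polynomial of Δ satisfies f(Δ,t) = (1+t)^d (1 + j t); equivalently, for each i ≥ 0 the number of faces of Δ with exactly i elements is C(d, i) + j·C(d, i−1), where C denotes the binomial coefficient. -/
open Finset Polynomial

/-- `L = [F_1, …, F_j]` is a stacked shelling of a pure `d`-dimensional complex:
the `F_l` are distinct faces of cardinality `d + 1` and, for each `1 ≤ i ≤ j - 1`,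
`⟨F_1, …, F_i⟩ ∩ ⟨F_{i+1}⟩` is the powerset of some `d`-element subset of `F_{i+1}`. -/
def IsStackedShelling {V : Type*} [DecidableEq V] (d : ℕ) (L : List (Finset V)) : Prop :=
  L ≠ [] ∧ L.Nodup ∧ (∀ F ∈ L, F.card = d + 1) ∧
  ∀ i : Fin L.length, 0 < i.1 →
    ∃ R ⊆ L.get i, R.card = d ∧ genL (L.take i.1) ∩ (L.get i).powerset = R.powerset

/-- A stacked simplicial complex of dimension `d`: one generated by a stacked shelling. -/
def IsStacked {V : Type*} [DecidableEq V] (Δ : Finset (Finset V)) (d : ℕ) : Prop :=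
  ∃ L : List (Finset V), IsStackedShelling d L ∧ Δ = genL L

theorem sum_powerset_X_pow_card {V : Type*} (F : Finset V) :
    ∑ σ ∈ F.powerset, (X : Polynomial ℤ) ^ σ.card = (1 + X) ^ F.card := by
  simpa [add_comm] using Finset.sum_pow_mul_eq_add_pow (X : Polynomial ℤ) 1 F

theorem genL_append_singleton {V : Type*} [DecidableEq V] (L : List (Finset V)) (F : Finset V) :
    genL (L ++ [F]) = genL L ∪ F.powerset := by
  ext σ
  simp [genL, or_comm]

theorem IsStackedShelling.sum_genL_take {V : Type*} [DecidableEq V] {d : ℕ}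
    {L : List (Finset V)} (hL : IsStackedShelling d L) (k : ℕ) (hk : k < L.length) :
    ∑ σ ∈ genL (L.take (k + 1)), (X : Polynomial ℤ) ^ σ.card
      = (1 + X) ^ d * (1 + ((k + 1 : ℕ) : Polynomial ℤ) * X) := by
  obtain ⟨-, -, hcard, hstack⟩ := hL
  have hF : L[k].card = d + 1 := hcard _ (List.getElem_mem hk)
  rw [List.take_succ_eq_append_getElem hk, genL_append_singleton]
  induction k with
  | zero => simp [genL, sum_powerset_X_pow_card, hF, pow_succ]
  | succ k ih =>
    have hk' : k < L.length := by omega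
    obtain ⟨R, -, hR, hinter⟩ := hstack ⟨k + 1, hk⟩ k.succ_pos
    have ih' := ih hk' (hcard _ (List.getElem_mem hk'))
    rw [← genL_append_singleton, ← List.take_succ_eq_append_getElem hk'] at ih'
    have hsum := Finset.sum_union_inter (s₁ := genL (L.take (k + 1)))
      (s₂ := L[k + 1].powerset) (f := fun σ => (X : Polynomial ℤ) ^ σ.card)
    simp only [List.get_eq_getElem] at hinter
    rw [hinter, sum_powerset_X_pow_card, sum_powerset_X_pow_card, hR, hF, ih'] at hsum
    rw [eq_sub_of_add_eq hsum]
    push_cast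
    ring

theorem coeff_sum_X_pow_card {V : Type*} (Δ : Finset (Finset V)) (i : ℕ) :
    (∑ σ ∈ Δ, (X : Polynomial ℤ) ^ σ.card).coeff i
      = ((Δ.filter fun σ => σ.card = i).card : ℤ) := by
  simp [Polynomial.finsetSum_coeff, Polynomial.coeff_X_pow, eq_comm]

theorem coeff_one_add_X_pow_mul (d j i : ℕ) :
    ((1 + X) ^ d * (1 + (j : Polynomial ℤ) * X)).coeff i
      = ((d.choose i + j * (if i = 0 then 0 else d.choose (i - 1)) : ℕ) : ℤ) := by
  have h : (1 + X) ^ d * (1 + (j : Polynomial ℤ) * X)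
      = (1 + X) ^ d + (j : Polynomial ℤ) * ((1 + X) ^ d * X) := by ring
  rw [h, Polynomial.coeff_add, Polynomial.coeff_natCast_mul]
  cases i <;> simp [Polynomial.coeff_one_add_X_pow, Polynomial.coeff_mul_X]

/-- A `d`-dimensional stacked complex with `j` facets has f-polynomial
`f(Δ,t) = (1+t)^d (1 + j t)`; equivalently, the number of faces with exactly `i`
elements is `C(d,i) + j·C(d,i-1)` (where `C(d,-1) = 0`). -/
theorem stacked_f_polynomial
    {V : Type*} [DecidableEq V] (Δ : Finset (Finset V)) (d j : ℕ)
    (L : List (Finset V)) (hL : IsStackedShelling d L) (hΔ : Δ = genL L)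
    (hj : L.length = j) :
    (∑ σ ∈ Δ, (X : Polynomial ℤ) ^ σ.card)
        = (1 + X) ^ d * (1 + (j : Polynomial ℤ) * X) ∧
    ∀ i : ℕ, (Δ.filter fun σ => σ.card = i).card
        = d.choose i + j * (if i = 0 then 0 else d.choose (i - 1)) := by
  have hpos : 0 < L.length := List.length_pos_iff.mpr hL.1
  have hf : ∑ σ ∈ Δ, (X : Polynomial ℤ) ^ σ.card
      = (1 + X) ^ d * (1 + (j : Polynomial ℤ) * X) := by
    have h := hL.sum_genL_take (L.length - 1) (by omega)
    rwa [Nat.sub_add_cancel hpos, List.take_length, ← hΔ, hj] at h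
  refine ⟨hf, fun i => ?_⟩
  have h := congrArg (fun p => Polynomial.coeff p i) hf
  simp only [coeff_sum_X_pow_card, coeff_one_add_X_pow_mul] at h
  exact_mod_cast h
end
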